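/- arXiv:2605.04043 — 2 statements merged into one kernel-verified Lean document; each statement's English description precedes it below -/
import Mathlib

section
/- If M is a quasi series-parallel matroid, then its dual matroid M* is also a quasi series-parallel matroid. -/
open Set

/-- `C` is a circuit of the matroid `M`: a minimal dependent set. -/
def Matroid.IsCircuit' {α : Type*} (M : Matroid α) (C : Set α) : Prop :=
  M.Dep C ∧ ∀ D ⊂ C, M.Indep D

/-- Two elements `e, f` of the ground set are connected: `e = f` or some circuit of `M`
contains both. -/
def Matroid.Conn {α : Type*} (M : Matroid α) (e f : α) : Prop :=
  e ∈ M.E ∧ f ∈ M.E ∧ (e = f ∨ ∃ C, M.IsCircuit' C ∧ e ∈ C ∧ f ∈ C)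

/-- The connected component of an element `e` of the ground set. -/
def Matroid.component {α : Type*} (M : Matroid α) (e : α) : Set α :=
  {f | M.Conn e f}

/-- `M` is connected: its ground set is nonempty and any two elements of the ground set
are connected. -/
def Matroid.IsConnected {α : Type*} (M : Matroid α) : Prop :=
  M.E.Nonempty ∧ ∀ e ∈ M.E, ∀ f ∈ M.E, M.Conn e f

/-- Deletion of a single element: restriction to the complement of `{e}`. -/
def Matroid.deleteElem' {α : Type*} (M : Matroid α) (e : α) : Matroid α :=
  M.restrict (M.E \ {e})

/-- Contraction of a single element, defined by duality: `M / e = (M✶ \ e)✶`. -/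
def Matroid.contractElem' {α : Type*} (M : Matroid α) (e : α) : Matroid α :=
  ((M✶).restrict (M.E \ {e}))✶

/-- `M'` is a parallel extension of `M`: some element `e` of `M'` lies in a circuit of
cardinality 2 of `M'`, and `M' \ e = M`. -/
def Matroid.ParallelExtension {α : Type*} (M M' : Matroid α) : Prop :=
  ∃ e ∈ M'.E, (∃ C, M'.IsCircuit' C ∧ e ∈ C ∧ C.ncard = 2) ∧ M'.deleteElem' e = M

/-- `M'` is a series extension of `M`: some element `e` of `M'` lies in a cocircuit of
cardinality 2 of `M'` (i.e. a circuit of the dual), and `M' / e = M`. -/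
def Matroid.SeriesExtension {α : Type*} (M M' : Matroid α) : Prop :=
  ∃ e ∈ M'.E, (∃ C, (M'✶).IsCircuit' C ∧ e ∈ C ∧ C.ncard = 2) ∧ M'.contractElem' e = M

/-- A series-parallel matroid: one obtained from a single loop or a single coloop by a
finite (possibly empty) sequence of series and parallel extensions. -/
inductive Matroid.SeriesParallel {α : Type*} : Matroid α → Prop
  | loop (e : α) : Matroid.SeriesParallel (Matroid.loopyOn {e})
  | coloop (e : α) : Matroid.SeriesParallel (Matroid.freeOn {e})
  | parallel {M M' : Matroid α} : Matroid.SeriesParallel M →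
      Matroid.ParallelExtension M M' → Matroid.SeriesParallel M'
  | series {M M' : Matroid α} : Matroid.SeriesParallel M →
      Matroid.SeriesExtension M M' → Matroid.SeriesParallel M'

/-- A quasi series-parallel matroid: the restriction to each connected component is a
series-parallel matroid. -/
def Matroid.QuasiSeriesParallel {α : Type*} (M : Matroid α) : Prop :=
  ∀ e ∈ M.E, Matroid.SeriesParallel (M.restrict (M.component e))

/-- A matroid is simple if it has no loops (circuits of cardinality 1) and no circuits of
cardinality 2. -/
def Matroid.IsSimple' {α : Type*} (M : Matroid α) : Prop :=
  ∀ C, M.IsCircuit' C → C.ncard ≠ 1 ∧ C.ncard ≠ 2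

namespace Matroid

variable {α : Type*} {M M' : Matroid α} {C C₁ C₂ K : Set α} {e f g : α}

lemma isCircuit'_iff : M.IsCircuit' C ↔ M.IsCircuit C :=
  isCircuit_iff_forall_ssubset.symm

/-- Two elements of intersecting circuits lie in a common circuit. -/
lemma IsCircuit.exists_isCircuit_mem_mem_of_inter_nonempty (hE : M.E.Finite)
    (hC₁ : M.IsCircuit C₁) (hC₂ : M.IsCircuit C₂) (he : e ∈ C₁) (hg : g ∈ C₂)
    (hne : (C₁ ∩ C₂).Nonempty) : ∃ C, M.IsCircuit C ∧ e ∈ C ∧ g ∈ C := by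
  induction hn : (C₁ ∪ C₂).ncard using Nat.strong_induction_on generalizing C₁ C₂ with
  | _ n ih =>
  subst hn
  have hfin : (C₁ ∪ C₂).Finite := hE.subset (union_subset hC₁.subset_ground hC₂.subset_ground)
  by_cases he₂ : e ∈ C₂
  · exact ⟨C₂, hC₂, he₂, hg⟩
  by_cases hg₁ : g ∈ C₁
  · exact ⟨C₁, hC₁, he, hg₁⟩
  obtain ⟨x, hx₁, hx₂⟩ := hne
  obtain ⟨C₃, hC₃ss, hC₃, he₃⟩ := hC₁.strong_elimination hC₂ hx₁ hx₂ he he₂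
  obtain ⟨C₄, hC₄ss, hC₄, hg₄⟩ := hC₂.strong_elimination hC₁ hx₂ hx₁ hg hg₁
  have h₃₂ : (C₃ ∩ C₂).Nonempty := by
    by_contra! h
    have hss : C₃ ⊆ C₁ := fun y hy ↦ (hC₃ss hy).1.resolve_right fun hy₂ ↦
      notMem_empty y (h.subset ⟨hy, hy₂⟩)
    exact (hC₃ss (hC₃.eq_of_subset_isCircuit hC₁ hss ▸ hx₁)).2 rfl
  obtain ⟨y, hy₄, hy₂⟩ : ∃ y ∈ C₄, y ∉ C₂ := by
    by_contra! h
    exact (hC₄ss (hC₄.eq_of_subset_isCircuit hC₂ h ▸ hx₂)).2 rfl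
  have hy₁ : y ∈ C₁ := (hC₄ss hy₄).1.resolve_left hy₂
  by_cases hy₃ : y ∈ C₃
  · refine ih _ (ncard_lt_ncard ⟨?_, fun h ↦ ?_⟩ hfin) hC₃ hC₄ he₃ hg₄ ⟨y, hy₃, hy₄⟩ rfl
    · exact union_subset (fun z hz ↦ (hC₃ss hz).1) (fun z hz ↦ (hC₄ss hz).1.symm)
    · exact (h (.inl hx₁)).elim (fun h ↦ (hC₃ss h).2 rfl) (fun h ↦ (hC₄ss h).2 rfl)
  · refine ih _ (ncard_lt_ncard ⟨?_, fun h ↦ ?_⟩ hfin) hC₃ hC₂ he₃ hg h₃₂ rfl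
    · exact union_subset (fun z hz ↦ (hC₃ss hz).1) subset_union_right
    · exact (h (.inl hy₁)).elim hy₃ hy₂

/-- Two elements of a circuit lie in a common cocircuit. -/
lemma IsCircuit.exists_isCocircuit_mem_mem (hC : M.IsCircuit C) (he : e ∈ C) (hf : f ∈ C)
    (hef : e ≠ f) : ∃ K, M.IsCocircuit K ∧ e ∈ K ∧ f ∈ K := by
  have hI := hC.sdiff_singleton_indep he
  obtain ⟨B, hB, hss⟩ := hI.exists_isBase_superset
  have hfB : f ∈ B := hss ⟨hf, hef.symm⟩
  have hCB : C ⊆ insert e B := by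
    rwa [sdiff_singleton_subset_iff] at hss
  refine ⟨M.fundCocircuit f B, fundCocircuit_isCocircuit hfB hB, ?_, M.mem_fundCocircuit f B⟩
  rw [hB.mem_fundCocircuit_iff_mem_fundCircuit, ← hC.eq_fundCircuit_of_subset hB.indep hCB]
  exact hf

lemma Conn.dual (h : M.Conn e f) : M✶.Conn e f := by
  obtain ⟨he, hf, h⟩ := h
  refine ⟨he, hf, or_iff_not_imp_left.2 fun hef ↦ ?_⟩
  obtain ⟨C, hC, heC, hfC⟩ := h.resolve_left hef
  obtain ⟨K, hK, heK, hfK⟩ := (isCircuit'_iff.1 hC).exists_isCocircuit_mem_mem heC hfC hef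
  exact ⟨K, isCircuit'_iff.2 hK, heK, hfK⟩

lemma component_dual (M : Matroid α) (e : α) : M✶.component e = M.component e :=
  Set.ext fun _ ↦ ⟨fun h ↦ by simpa [component] using Conn.dual h, Conn.dual⟩

lemma component_subset_ground (M : Matroid α) (e : α) : M.component e ⊆ M.E :=
  fun _ h ↦ h.2.1

lemma IsCircuit.subset_component (hE : M.E.Finite) (hC : M.IsCircuit C) (hfC : f ∈ C)
    (hf : f ∈ M.component e) : C ⊆ M.component e := by
  intro g hg
  obtain ⟨he, -, rfl | ⟨D, hD, heD, hfD⟩⟩ := hf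
  · exact ⟨he, hC.subset_ground hg, .inr ⟨C, isCircuit'_iff.2 hC, hfC, hg⟩⟩
  obtain ⟨C', hC', heC', hgC'⟩ := (isCircuit'_iff.1 hD).exists_isCircuit_mem_mem_of_inter_nonempty
    hE hC heD hg ⟨f, hfD, hfC⟩
  exact ⟨he, hC.subset_ground hg, .inr ⟨C', isCircuit'_iff.2 hC', heC', hgC'⟩⟩

/-- If every circuit meeting `K` is contained in `K`, then restricting to `K` agrees with
contracting the complement of `K`. -/
lemma restrict_eq_contract_compl (hK : K ⊆ M.E)
    (h : ∀ C, M.IsCircuit C → (C ∩ K).Nonempty → C ⊆ K) :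
    M.restrict K = M.contract (M.E \ K) := by
  refine ext_indep (by simp [inter_eq_self_of_subset_right hK]) fun I (hIK : I ⊆ K) ↦ ?_
  obtain ⟨J, hJ⟩ := M.exists_isBasis (M.E \ K)
  rw [restrict_indep_iff, and_iff_left hIK,
    hJ.contract_indep_iff_of_disjoint (disjoint_sdiff_left.mono_right hIK)]
  refine ⟨fun hI ↦ ?_, fun hIJ ↦ hIJ.subset subset_union_left⟩
  rw [indep_iff_forall_subset_not_isCircuit (union_subset hI.subset_ground hJ.indep.subset_ground)]
  intro C hCIJ hC
  by_cases hCK : (C ∩ K).Nonempty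
  · refine hC.not_indep (hI.subset fun x hx ↦ (hCIJ hx).resolve_right fun hxJ ↦ ?_)
    exact (hJ.subset hxJ).2 (h C hC hCK hx)
  · refine hC.not_indep (hJ.indep.subset fun x hx ↦ (hCIJ hx).resolve_left fun hxI ↦ ?_)
    exact hCK ⟨x, hx, hIK hxI⟩

lemma dual_restrict_component (hE : M.E.Finite) (e : α) :
    (M✶).restrict (M.component e) = (M.restrict (M.component e))✶ := by
  rw [restrict_eq_contract_compl (M.component_subset_ground e)
    fun C hC ⟨_, hfC, hf⟩ ↦ hC.subset_component hE hfC hf, dual_contract, ← dual_ground,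
    delete_compl (show _ ⊆ M✶.E from M.component_subset_ground e)]

lemma ParallelExtension.dual (h : M.ParallelExtension M') : M✶.SeriesExtension M'✶ := by
  obtain ⟨e, he, hC, rfl⟩ := h
  exact ⟨e, he, by rwa [dual_dual], by simp [contractElem', deleteElem']⟩

lemma SeriesExtension.dual (h : M.SeriesExtension M') : M✶.ParallelExtension M'✶ := by
  obtain ⟨e, he, hC, rfl⟩ := h
  exact ⟨e, he, hC, by simp [contractElem', deleteElem']⟩

lemma SeriesParallel.dual (h : M.SeriesParallel) : M✶.SeriesParallel := by
  induction h with
  | loop e => exact loopyOn_dual_eq ▸ .coloop e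
  | coloop e => exact freeOn_dual_eq ▸ .loop e
  | parallel _ h ih => exact .series ih h.dual
  | series _ h ih => exact .parallel ih h.dual

end Matroid

/-!
STATEMENT 2: If M is a quasi series-parallel matroid, then its dual matroid M* is also a
quasi series-parallel matroid.
-/
theorem dual_quasiSeriesParallel {α : Type*} (M : Matroid α) (hE : M.E.Finite)
    (h : M.QuasiSeriesParallel) : (M✶).QuasiSeriesParallel := by
  intro e he
  rw [Matroid.component_dual, Matroid.dual_restrict_component hE]
  exact (h e he).dual
end

section
/- The map ν : G → (G ≀ S_n) ⋊ Aut(G) defined by ν(g) = ((g,…,g), id, inn_g) is an injective group homomorphism, and its image N = {((g,…,g), id, inn_g) : g ∈ G} is a normal subgroup of (G ≀ S_n) ⋊ Aut(G). -/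
/-- The underlying set of the group `(G ≀ Sₙ) ⋊ Aut(G)`: tuples
`((g₁,…,gₙ), σ, φ) ∈ Gⁿ × Sₙ × Aut(G)`. -/
abbrev DowGroup (G : Type*) [Group G] (n : ℕ) :=
  (Fin n → G) × Equiv.Perm (Fin n) × MulAut G

/-- The multiplication `((g₁,…,gₙ), σ, φ)·((h₁,…,hₙ), τ, ψ) =
((φ(h₁)g_{τ(1)}, …, φ(hₙ)g_{τ(n)}), στ, φψ)`. -/
def dowMul {G : Type*} [Group G] {n : ℕ} (a b : DowGroup G n) : DowGroup G n :=
  (fun i => a.2.2 (b.1 i) * a.1 (b.2.1 i), a.2.1 * b.2.1, a.2.2 * b.2.2)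

/-- The element `((1,…,1), id, id)`. -/
def dowOne {G : Type*} [Group G] {n : ℕ} : DowGroup G n :=
  (fun _ => 1, 1, 1)

/-- The map `ν : G → (G ≀ Sₙ) ⋊ Aut(G)`, `ν(g) = ((g,…,g), id, inn_g)`, where `inn_g` is
the inner automorphism `h ↦ ghg⁻¹`. -/
def dowNu {G : Type*} [Group G] (n : ℕ) (g : G) : DowGroup G n :=
  (fun _ => g, 1, MulAut.conj g)

/-!
STATEMENT 7: ν is an injective group homomorphism, and its image
N = {((g,…,g), id, inn_g) : g ∈ G} is a normal subgroup of (G ≀ Sₙ) ⋊ Aut(G)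
(normality formulated as: for every w and every x ∈ N there is y ∈ N with w·x = y·w).
-/
theorem dowNu_injective_hom_normal_image (G : Type*) [Group G] (n : ℕ) (hn : 1 ≤ n) :
    (∀ g h : G, dowMul (dowNu n g) (dowNu n h) = dowNu n (g * h)) ∧
    Function.Injective (dowNu (G := G) n) ∧
    (∀ w : DowGroup G n, ∀ x ∈ Set.range (dowNu (G := G) n),
      ∃ y ∈ Set.range (dowNu (G := G) n), dowMul w x = dowMul y w) := by
  refine ⟨fun g h => ?_, fun g h hgh => ?_, ?_⟩
  · simp [dowMul, dowNu]
  · exact congrFun (congrArg Prod.fst hgh) ⟨0, hn⟩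
  · rintro ⟨f, σ, φ⟩ _ ⟨g, rfl⟩
    refine ⟨dowNu n (φ g), ⟨φ g, rfl⟩, ?_⟩
    have hconj : φ * MulAut.conj g = MulAut.conj (φ g) * φ := by
      ext x
      simp
    simp [dowMul, dowNu, hconj]
end
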